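/- Let p : (Fin m → ℝ) → (Fin K → ℝ) be a differentiable family of probability distributions in the sense that Σ_l p_l(θ') = 1 for all θ', and fix θ with p_l(θ) > 0 for all l and with p_l(θ + ε) > 0 for ε in a neighborhood of 0. Define KL(ε) = Σ_l p_l(θ)·log(p_l(θ)/p_l(θ + ε)). Then the Fréchet derivative of KL at ε = 0 is zero; i.e., the first-order term in the Taylor expansion of the KL-divergence between p(θ) and p(θ+ε) vanishes. -/

import Mathlib

/-- The map `ε ↦ KL(p(θ)‖p(θ+ε))` is differentiable at `0` with zero derivative. -/
theorem hasFDerivAt_klDiv_shift_zero {E ι : Type*} [NormedAddCommGroup E] [NormedSpace ℝ E]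
    [Fintype ι] {p : E → ι → ℝ} {θ : E} (hdiff : DifferentiableAt ℝ p θ)
    (hsum : ∀ θ', ∑ l, p θ' l = 1) (hpos : ∀ l, 0 < p θ l) :
    HasFDerivAt (fun ε => ∑ l, p θ l * Real.log (p θ l / p (θ + ε) l)) (0 : E →L[ℝ] ℝ) 0 := by
  have hp (l : ι) : HasFDerivAt (fun ε => p (θ + ε) l) (fderiv ℝ (fun x => p x l) θ) 0 := by
    rw [hasFDerivAt_comp_add_left (f := fun x => p x l), add_zero]
    exact (differentiableAt_pi.1 hdiff l).hasFDerivAt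
  have hsum_fderiv : ∑ l, fderiv ℝ (fun x => p x l) θ = 0 := by
    have h := HasFDerivAt.fun_sum (u := Finset.univ) fun l _ => hp l
    simp only [hsum] at h
    exact h.unique (hasFDerivAt_const 1 0)
  have hterm (l : ι) : HasFDerivAt (fun ε => p θ l * Real.log (p θ l / p (θ + ε) l))
      (-fderiv ℝ (fun x => p x l) θ) 0 := by
    have hl : p θ l ≠ 0 := (hpos l).ne'
    have hl' : p (θ + 0) l ≠ 0 := by rwa [add_zero]
    have h := (((hp l).log hl').const_sub (Real.log (p θ l))).const_mul (p θ l)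
    rw [add_zero, smul_neg, smul_inv_smul₀ hl] at h
    refine h.congr_of_eventuallyEq ?_
    filter_upwards [(hp l).continuousAt.eventually_ne hl'] with ε hε
    rw [Real.log_div hl hε]
  have h := HasFDerivAt.fun_sum (u := Finset.univ) fun l _ => hterm l
  rwa [Finset.sum_neg_distrib, hsum_fderiv, neg_zero] at h


/-- The first-order term of the Taylor expansion of the KL-divergence
`KL(ε) = Σ_l p_l(θ)·log(p_l(θ)/p_l(θ+ε))` between `p(θ)` and `p(θ+ε)` vanishes
at `ε = 0`: its Fréchet derivative at `0` is zero. -/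
theorem KL_first_order_term_vanishes {m K : ℕ}
    (p : (Fin m → ℝ) → Fin K → ℝ) (hdiff : Differentiable ℝ p)
    (hsum : ∀ θ', ∑ l, p θ' l = 1)
    (θ : Fin m → ℝ) (hpos : ∀ l, 0 < p θ l)
    (U : Set (Fin m → ℝ)) (hU : U ∈ nhds (0 : Fin m → ℝ))
    (hposU : ∀ ε ∈ U, ∀ l, 0 < p (θ + ε) l)
    (KLdiv : (Fin m → ℝ) → ℝ)
    (hKL : ∀ ε, KLdiv ε = ∑ l, p θ l * Real.log (p θ l / p (θ + ε) l)) :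
    fderiv ℝ KLdiv 0 = 0 := by
  rw [funext hKL]
  exact (hasFDerivAt_klDiv_shift_zero (hdiff θ) hsum hpos).fderiv
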